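/- Fix a real number p with 0 < p ≤ 1. There exists δ₀ > 0 such that for every real δ with 0 < δ < δ₀ and every real ε > 0 there exists an integer n₀ with the following property: for all integers n₁ ≥ n₂ > n₀, the probability that the binomial random graph G(⌈(4+δ)n₁⌉, p) arrows (C_{2n₁+1}, C_{2n₂+1}) is at least 1 − ε. -/

import Mathlib

-- Probability, under the binomial random graph model `G(N,p)`, of a set of graphs
-- on the vertex set `Fin N`: each possible edge is present independently with probability `p`.
open Classical in
noncomputable def graphProbability (N : ℕ) (p : ℝ) (E : Set (SimpleGraph (Fin N))) : ℝ :=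
  ∑ G : SimpleGraph (Fin N),
    if G ∈ E then p ^ (Nat.card G.edgeSet) * (1 - p) ^ (N.choose 2 - Nat.card G.edgeSet) else 0

/-- `F` has a cycle of length `m`, all of whose edges get color `i` under `c`. -/
def HasMonoCycle {V : Type*} (F : SimpleGraph V) {k : ℕ} (c : F.edgeSet → Fin k)
    (i : Fin k) (m : ℕ) : Prop :=
  ∃ (v : V) (w : F.Walk v v), w.IsCycle ∧ w.length = m ∧
    ∀ e (h : e ∈ w.edges), c ⟨e, w.edges_subset_edgeSet h⟩ = i

/-- `F → (C_{n 0}, …, C_{n (k-1)})`: every `k`-coloring of the edges of `F` yields,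
for some color `i`, a cycle on `n i` vertices all of whose edges have color `i`. -/
def ArrowsCycles {V : Type*} (F : SimpleGraph V) {k : ℕ} (n : Fin k → ℕ) : Prop :=
  ∀ c : F.edgeSet → Fin k, ∃ i : Fin k, HasMonoCycle F c i (n i)

section

open Finset
open scoped Classical

/-- Any two large subsets of `A` and `B` span at least the proportion `d` of all edges. -/
def LowerDense {V : Type*} (H : SimpleGraph V) (d : ℝ) (t : ℕ) (A B : Finset V) : Prop :=
  ∀ X ⊆ A, ∀ Y ⊆ B, t ≤ #X → t ≤ #Y → d * #X * #Y ≤ #(H.interedges X Y)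

lemma LowerDense.card_low_degree_lt {V : Type*} {H : SimpleGraph V} {d : ℝ} {t : ℕ}
    {A B : Finset V} (h : LowerDense H d t A B) (ht : 0 < t) {Y : Finset V} (hY : Y ⊆ B)
    (hYt : t ≤ #Y) {a : ℕ} (ha : a ≤ d * #Y) :
    #{x ∈ A | #{y ∈ Y | H.Adj x y} < a} < t := by
  by_contra! hS
  set S := {x ∈ A | #{y ∈ Y | H.Adj x y} < a} with hSdef
  have h1 := h S (filter_subset _ _) Y hY hS hYt
  have h2 : #(H.interedges S Y) = ∑ x ∈ S, #{y ∈ Y | H.Adj x y} := by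
    rw [SimpleGraph.interedges_def, card_filter, sum_product]
    exact sum_congr rfl fun x _ ↦ (card_filter _ _).symm
  have hne : S.Nonempty := card_pos.1 (by omega)
  have h3 : ∑ x ∈ S, #{y ∈ Y | H.Adj x y} < ∑ _x ∈ S, a :=
    sum_lt_sum_of_nonempty hne fun x hx ↦ (mem_filter.1 hx).2
  rw [← h2, sum_const, smul_eq_mul] at h3
  have h4 : (#(H.interedges S Y) : ℝ) < #S * a := by exact_mod_cast h3
  have h5 : (#S : ℝ) * a ≤ #S * (d * #Y) := by gcongr
  linarith

/-- Greedy embedding of a walk of the cluster graph, followed by a vertex of `Z` and by `x₀`: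
all but few vertices of the first cluster are the start of such a path avoiding `F`. -/
lemma card_not_start_lt {ι V : Type*} {H : SimpleGraph V} {Γ : SimpleGraph ι}
    {W : ι → Finset V} {d : ℝ} {s t : ℕ} (ht : 0 < t) (hdt : 1 ≤ d * t) (hds : t ≤ d * s)
    (hts : t ≤ s) (hdisj : ∀ a b, a ≠ b → Disjoint (W a) (W b))
    (hdense : ∀ a b, Γ.Adj a b → LowerDense H d t (W a) (W b))
    {x₀ : V} {Z : Finset V} {j : ι} (hZ : Z ⊆ W j) (htZ : t ≤ #Z) (hZx : ∀ z ∈ Z, H.Adj z x₀)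
    {i k : ι} (w : Γ.Walk i k) (hkj : Γ.Adj k j) :
    ∀ F : Finset V, Disjoint F (insert x₀ Z) →
      (∀ a, w.support.count a + s ≤ #(W a \ (F ∪ insert x₀ Z))) →
      #{x ∈ W i \ (F ∪ insert x₀ Z) | ¬ ∃ p : H.Walk x x₀, p.IsPath ∧ p.length = w.length + 2 ∧
        (∀ v ∈ p.support, v ∉ F) ∧ s(x₀, x) ∉ p.edges} < t := by
  induction w with
  | nil =>
    rename_i u
    intro F hF _
    refine (card_le_card ?_).trans_lt
      ((hdense _ _ hkj).card_low_degree_lt ht hZ htZ (a := 1) ?_)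
    · intro x hx
      simp only [mem_filter, mem_sdiff, mem_union, mem_insert, not_or] at hx ⊢
      refine ⟨hx.1.1, ?_⟩
      by_contra! hlow
      obtain ⟨z, hz⟩ := card_pos.1 (by omega : 0 < #{y ∈ Z | H.Adj x y})
      rw [mem_filter] at hz
      apply hx.2
      have hzx := hZx z hz.1
      have hxz : x ≠ z := hz.2.ne
      have hzx' : z ≠ x₀ := hzx.ne
      have hFz : z ∉ F := fun h ↦ disjoint_left.1 hF h (by simp [hz.1])
      have hFx : x₀ ∉ F := fun h ↦ disjoint_left.1 hF h (by simp)
      refine ⟨.cons hz.2 (.cons hzx .nil), ?_, by simp, ?_, ?_⟩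
      · simp [SimpleGraph.Walk.cons_isPath_iff, hzx', hxz, hx.1.2.2.1]
      · simp [hFz, hFx, hx.1.2.1]
      · have := hx.1.2.2.1
        simp [Ne.symm hzx', Ne.symm this, hxz]
    · push_cast
      refine hdt.trans ?_
      have hd : 0 ≤ d := by
        by_contra! hd
        have : d * t ≤ 0 := mul_nonpos_of_nonpos_of_nonneg hd.le (by positivity)
        linarith
      gcongr
  | cons hadj w ih =>
    rename_i u v k
    intro F hF hcount
    set S := insert x₀ Z with hS
    have hYs : s ≤ #(W v \ (F ∪ S)) := le_trans (by omega) (hcount v)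
    have hd : 0 ≤ d := by
      by_contra! hd
      have : d * t ≤ 0 := mul_nonpos_of_nonpos_of_nonneg hd.le (by positivity)
      linarith
    refine (card_le_card ?_).trans_lt ((hdense _ _ hadj).card_low_degree_lt ht
      (Y := W v \ (F ∪ S)) sdiff_subset (hts.trans hYs) (a := t)
      (hds.trans (by gcongr)))
    intro x hx
    rw [mem_filter] at hx ⊢
    obtain ⟨hx, hbad⟩ := hx
    rw [mem_sdiff] at hx
    refine ⟨hx.1, ?_⟩
    by_contra! hlow
    have hxF : x ∉ F := fun h ↦ hx.2 (by simp [h])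
    have hxS : x ∉ S := fun h ↦ hx.2 (by simp [h])
    have hF' : Disjoint (insert x F) S := by
      rw [disjoint_insert_left]; exact ⟨hxS, hF⟩
    have hlt := ih hkj (insert x F) hF' (by
      intro a
      have h1 := hcount a
      have h2 : W a \ (insert x F ∪ S) = (W a \ (F ∪ S)).erase x := by
        ext y; simp only [mem_sdiff, mem_union, mem_insert, mem_erase]; tauto
      rw [h2]
      rw [SimpleGraph.Walk.support_cons, List.count_cons] at h1
      by_cases hau : u = a
      · subst hau
        have := pred_card_le_card_erase (s := W u \ (F ∪ S)) (a := x)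
        simp at h1
        omega
      · have : x ∉ W a \ (F ∪ S) := fun h ↦
          disjoint_left.1 (hdisj u a hau) hx.1 (mem_sdiff.1 h).1
        rw [erase_eq_of_notMem this]
        simp [hau] at h1
        omega)
    obtain ⟨y, hyN, hyB⟩ := exists_mem_notMem_of_card_lt_card (hlt.trans_le hlow)
    simp only [mem_filter, mem_sdiff, mem_union, mem_insert, not_or, not_and, not_not] at hyN hyB
    have hxy : x ≠ y := hyN.2.ne
    obtain ⟨p, hp, hlen, hav, -⟩ := hyB ⟨hyN.1.1, ⟨hxy.symm, hyN.1.2.1⟩, hyN.1.2.2⟩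
    have hxp : x ∉ p.support := fun h ↦ (hav x h).1 rfl
    refine hbad ⟨.cons hyN.2 p, ?_, by simp [hlen], ?_, ?_⟩
    · rw [SimpleGraph.Walk.cons_isPath_iff]; exact ⟨hp, hxp⟩
    · intro v hv
      rw [SimpleGraph.Walk.support_cons, List.mem_cons] at hv
      rcases hv with rfl | hv
      · exact hxF
      · exact fun h ↦ (hav v hv).2 h
    · rw [SimpleGraph.Walk.edges_cons, List.mem_cons, not_or]
      have hyx : y ≠ x₀ := fun h ↦ hyN.1.2.2 (by simp [hS, h])
      refine ⟨?_, fun h ↦ hxp (p.snd_mem_support_of_mem_edges h)⟩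
      rw [Sym2.eq_iff]
      rintro (⟨-, h⟩ | ⟨h, -⟩)
      · exact hxy h
      · exact hyx h.symm

/-- A closed walk of the cluster graph using no cluster too often embeds as a cycle. -/
lemma exists_isCycle_of_closed_walk {ι V : Type*} {H : SimpleGraph V} {Γ : SimpleGraph ι}
    {W : ι → Finset V} {d : ℝ} {s t : ℕ} (ht : 0 < t) (hdt : 1 ≤ d * t) (hds : t ≤ d * s)
    (hts : t ≤ s) (hdisj : ∀ a b, a ≠ b → Disjoint (W a) (W b))
    (hdense : ∀ a b, Γ.Adj a b → LowerDense H d t (W a) (W b))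
    {r : ι} (w : Γ.Walk r r) (hw : 3 ≤ w.length)
    (hcount : ∀ a, w.support.count a + 2 * s + 1 ≤ #(W a)) :
    ∃ (x : V) (c : H.Walk x x), c.IsCycle ∧ c.length = w.length := by
  have hd : 0 ≤ d := by
    by_contra! hd
    have : d * t ≤ 0 := mul_nonpos_of_nonpos_of_nonneg hd.le (by positivity)
    linarith
  match w, hw, hcount with
  | .cons (v := j) h1 (.cons (v := i) h2 (.cons (v := u) h3 w3)), _, hcount =>
    have hcount3 : ∀ a, w3.support.count a + 2 * s + 1 ≤ #(W a) := by
      intro a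
      refine le_trans ?_ (hcount a)
      simp only [SimpleGraph.Walk.support_cons, List.count_cons]
      omega
    obtain ⟨Y, hYW, hYs⟩ := exists_subset_card_eq (show s ≤ #(W j) by have := hcount3 j; omega)
    have hU : s ≤ #(W u \ Y) := by
      have := le_card_sdiff Y (W u)
      have := hcount3 u
      omega
    have b1 := (hdense i j h2.symm).card_low_degree_lt ht hYW (hYs ▸ hts) (a := t)
      (hYs ▸ hds)
    have b2 := (hdense i u h3).card_low_degree_lt ht (Y := W u \ Y) sdiff_subset (hts.trans hU)
      (a := t) (hds.trans (by gcongr))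
    have hWi : #({x ∈ W i | #{y ∈ Y | H.Adj x y} < t} ∪
        {x ∈ W i | #{y ∈ W u \ Y | H.Adj x y} < t}) < #(W i) := by
      have := card_union_le {x ∈ W i | #{y ∈ Y | H.Adj x y} < t}
        {x ∈ W i | #{y ∈ W u \ Y | H.Adj x y} < t}
      have := hcount3 i
      omega
    obtain ⟨x₀, hx₀, hx₀'⟩ := exists_mem_notMem_of_card_lt_card hWi
    simp only [mem_union, mem_filter, hx₀, true_and, not_or, not_lt] at hx₀'
    have key := card_not_start_lt ht hdt hds hts hdisj hdense (x₀ := x₀)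
      (Z := {y ∈ Y | H.Adj x₀ y}) (j := j) ((filter_subset _ _).trans hYW) hx₀'.1
      (fun z hz ↦ (mem_filter.1 hz).2.symm) w3 h1 ∅ (by simp) (by
        intro a
        have h4 := le_card_sdiff (∅ ∪ insert x₀ {y ∈ Y | H.Adj x₀ y}) (W a)
        have h5 : #(∅ ∪ insert x₀ {y ∈ Y | H.Adj x₀ y}) ≤ s + 1 := by
          rw [empty_union]
          refine (card_insert_le _ _).trans ?_
          have : #{y ∈ Y | H.Adj x₀ y} ≤ #Y := card_filter_le _ _
          omega
        have := hcount3 a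
        omega)
    obtain ⟨x₁, hx₁, hx₁'⟩ := exists_mem_notMem_of_card_lt_card (key.trans_le hx₀'.2)
    simp only [mem_filter, mem_sdiff, mem_union, mem_insert, notMem_empty, false_or, not_or,
      not_and, not_not] at hx₁ hx₁'
    obtain ⟨p, hp, hlen, -, he⟩ := hx₁' ⟨hx₁.1.1, hx₁.2.ne', fun h ↦ absurd h hx₁.1.2⟩
    exact ⟨x₀, .cons hx₁.2 p, (SimpleGraph.Walk.cons_isCycle_iff _ _).2 ⟨hp, he⟩, by simp [hlen]⟩

lemma exists_odd_closed_walk_through {ι : Type*} {Γ : SimpleGraph ι} {r : ι}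
    (h : ∃ w : Γ.Walk r r, Odd w.length) (S : Finset ι) (hS : ∀ v ∈ S, Γ.Reachable r v) :
    ∃ w : Γ.Walk r r, Odd w.length ∧ ∀ v ∈ S, v ∈ w.support := by
  induction S using Finset.induction_on with
  | empty => simpa using h
  | insert a S _ ih =>
    obtain ⟨w, hw, hws⟩ := ih fun v hv ↦ hS v (mem_insert_of_mem hv)
    obtain ⟨p⟩ := hS a (mem_insert_self _ _)
    refine ⟨(p.append p.reverse).append w, ?_, ?_⟩
    · simp only [SimpleGraph.Walk.length_append, SimpleGraph.Walk.length_reverse]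
      exact Even.add_odd ⟨_, rfl⟩ hw
    · intro v hv
      simp only [SimpleGraph.Walk.mem_support_append_iff]
      rcases mem_insert.1 hv with rfl | hv
      · simp
      · exact Or.inr (hws v hv)

/-- The lengths of suitable odd closed tours of components are bounded over all graphs with a
bounded number of vertices. -/
lemma exists_tour_bound (K : ℕ) : ∃ L : ℕ, ∀ k ≤ K, ∀ (Γ : SimpleGraph (Fin k)) (r : Fin k),
    (∃ w : Γ.Walk r r, Odd w.length) → ∃ w : Γ.Walk r r, Odd w.length ∧ w.length ≤ L ∧
      ∀ v, Γ.Reachable r v → v ∈ w.support := by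
  have main : ∀ k, ∀ x : SimpleGraph (Fin k) × Fin k, ∃ L : ℕ,
      (∃ w : x.1.Walk x.2 x.2, Odd w.length) →
      ∃ w : x.1.Walk x.2 x.2, Odd w.length ∧ w.length ≤ L ∧
        ∀ v, x.1.Reachable x.2 v → v ∈ w.support := by
    intro k x
    by_cases h : ∃ w : x.1.Walk x.2 x.2, Odd w.length
    · obtain ⟨w, hw, hws⟩ := exists_odd_closed_walk_through h {v | x.1.Reachable x.2 v} (by simp)
      exact ⟨w.length, fun _ ↦ ⟨w, hw, le_rfl, fun v hv ↦ hws v (by simpa using hv)⟩⟩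
    · exact ⟨0, fun h' ↦ absurd h' h⟩
  choose f hf using main
  refine ⟨(range (K + 1)).sup fun k ↦ univ.sup (f k), fun k hk Γ r h ↦ ?_⟩
  obtain ⟨w, hw, hl, hv⟩ := hf k (Γ, r) h
  refine ⟨w, hw, hl.trans ?_, hv⟩
  exact (le_sup (f := f k) (mem_univ (Γ, r))).trans
    (le_sup (f := fun k ↦ univ.sup (f k)) (mem_range.2 (by omega)))

lemma exists_bouncing_walk {ι : Type*} {Γ : SimpleGraph ι} {A B : ι} (h : Γ.Adj A B) (a : ℕ) :
    ∃ w : Γ.Walk A A, w.length = 2 * a ∧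
      ∀ v, w.support.tail.count v = if v = A ∨ v = B then a else 0 := by
  induction a with
  | zero => exact ⟨.nil, by simp⟩
  | succ a ih =>
    obtain ⟨w, hw, hc⟩ := ih
    refine ⟨.cons h (.cons h.symm w), by simp [hw]; ring, fun v ↦ ?_⟩
    have hAB := h.ne
    simp only [SimpleGraph.Walk.support_cons, List.tail_cons, List.count_cons]
    rw [← w.cons_tail_support, List.count_cons, hc]
    by_cases h1 : v = A
    · subst h1; simp [hAB.symm]
    · by_cases h2 : v = B
      · subst h2; simp [hAB]
      · simp [h1, h2, Ne.symm h1, Ne.symm h2]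

lemma exists_walk_insert_bounces {ι : Type*} {Γ : SimpleGraph ι} {r A B : ι} (h : Γ.Adj A B)
    (w : Γ.Walk r r) (hA : A ∈ w.support) (a : ℕ) :
    ∃ w' : Γ.Walk r r, w'.length = w.length + 2 * a ∧
      ∀ v, w'.support.count v = w.support.count v + if v = A ∨ v = B then a else 0 := by
  obtain ⟨b, hb, hc⟩ := exists_bouncing_walk h a
  refine ⟨(w.takeUntil A hA).append (b.append (w.dropUntil A hA)), ?_, fun v ↦ ?_⟩
  · have := congrArg SimpleGraph.Walk.length (w.take_spec hA)
    simp only [SimpleGraph.Walk.length_append] at this ⊢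
    omega
  · have := congrArg (fun p ↦ p.support.count v) (w.take_spec hA)
    rw [← hc v]
    simp only [SimpleGraph.Walk.support_append, List.count_append] at this ⊢
    rw [List.tail_append_of_ne_nil (by simp), List.count_append]
    omega

/-- A finite set of pairwise disjoint (directed) pairs. -/
def IsPairMatching {ι : Type*} (M : Finset (ι × ι)) : Prop :=
  ∀ v, #{e ∈ M | v = e.1 ∨ v = e.2} ≤ 1

lemma exists_walk_of_matching {ι : Type*} {Γ : SimpleGraph ι} {r : ι} (w : Γ.Walk r r) (c : ℕ)
    (M : Finset (ι × ι)) (hadj : ∀ e ∈ M, Γ.Adj e.1 e.2) (hw : ∀ e ∈ M, e.1 ∈ w.support) :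
    ∀ T ≤ #M * c, ∃ w' : Γ.Walk r r, w'.length = w.length + 2 * T ∧
      ∀ v, w.support.count v ≤ w'.support.count v ∧
        w'.support.count v ≤ w.support.count v + #{e ∈ M | v = e.1 ∨ v = e.2} * c := by
  induction M using Finset.induction_on with
  | empty => intro T hT; exact ⟨w, by simp_all⟩
  | insert e M he ih =>
    intro T hT
    rw [card_insert_of_notMem he, add_mul, one_mul] at hT
    obtain ⟨w₁, hl, hc⟩ := ih (fun e he ↦ hadj e (mem_insert_of_mem he))
      (fun e he ↦ hw e (mem_insert_of_mem he)) (T - min T c) (by omega)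
    have hmem : e.1 ∈ w₁.support := by
      rw [← List.count_pos_iff]
      exact (List.count_pos_iff.2 (hw e (mem_insert_self _ _))).trans_le (hc e.1).1
    obtain ⟨w₂, hl₂, hc₂⟩ := exists_walk_insert_bounces (hadj e (mem_insert_self _ _)) w₁ hmem
      (min T c)
    refine ⟨w₂, by omega, fun v ↦ ?_⟩
    have h1 := hc v
    rw [hc₂, filter_insert]
    split_ifs with hv
    · rw [card_insert_of_notMem (by simp [he]), add_mul, one_mul]
      omega
    · omega

/-- `Γ` has a non-bipartite component containing a matching with at least `n / 4` edges. -/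
def HasOddConnectedMatching {ι : Type*} (Γ : SimpleGraph ι) (n : ℕ) : Prop :=
  ∃ r, (∃ w : Γ.Walk r r, Odd w.length) ∧ ∃ M : Finset (ι × ι), IsPairMatching M ∧
    (∀ e ∈ M, Γ.Adj e.1 e.2 ∧ Γ.Reachable r e.1) ∧ n ≤ 4 * #M

lemma HasOddConnectedMatching.mono {ι : Type*} {Γ : SimpleGraph ι} {m n : ℕ} (hmn : m ≤ n)
    (h : HasOddConnectedMatching Γ n) : HasOddConnectedMatching Γ m := by
  obtain ⟨r, hw, M, h1, h2, h3⟩ := h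
  exact ⟨r, hw, M, h1, h2, hmn.trans h3⟩

lemma exists_maximal_pairMatching {ι : Type*} (Γ : SimpleGraph ι) (P : Finset ι) :
    ∃ (M : Finset (ι × ι)) (Q : Finset ι), IsPairMatching M ∧ Q ⊆ P ∧
      (∀ e ∈ M, Γ.Adj e.1 e.2 ∧ e.1 ∈ P ∧ e.2 ∈ P) ∧ (∀ u ∈ Q, ∀ v ∈ Q, ¬ Γ.Adj u v) ∧
      #Q + 2 * #M = #P := by
  induction P using Finset.strongInduction with
  | H P ih =>
    by_cases h : ∀ u ∈ P, ∀ v ∈ P, ¬ Γ.Adj u v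
    · exact ⟨∅, P, by simp [IsPairMatching], subset_rfl, by simp, h, by simp⟩
    · push Not at h
      obtain ⟨u, hu, v, hv, huv⟩ := h
      have hv' : v ∈ P.erase u := mem_erase.2 ⟨huv.ne', hv⟩
      have hsub : (P.erase u).erase v ⊂ P :=
        (erase_subset _ _).trans_ssubset (erase_ssubset hu)
      obtain ⟨M, Q, hM, hQ, hMa, hQi, hc⟩ := ih _ hsub
      have hnot : ∀ e ∈ M, e.1 ≠ u ∧ e.1 ≠ v ∧ e.2 ≠ u ∧ e.2 ≠ v := by
        intro e he
        have := hMa e he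
        simp only [mem_erase] at this
        tauto
      have huvM : (u, v) ∉ M := fun h ↦ (hnot _ h).1 rfl
      refine ⟨insert (u, v) M, Q, ?_, hQ.trans hsub.subset, ?_, hQi, ?_⟩
      · intro x
        rw [filter_insert]
        split_ifs with hx
        · have : {e ∈ M | x = e.1 ∨ x = e.2} = ∅ := by
            rw [filter_eq_empty_iff]
            intro e he h
            have := hnot e he
            grind
          simp [this]
        · exact hM x
      · intro e he
        rcases mem_insert.1 he with rfl | he
        · exact ⟨huv, hu, hv⟩
        · have := hMa e he
          simp only [mem_erase] at this
          tauto
      · rw [card_insert_of_notMem huvM]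
        have h1 := card_erase_of_mem hu
        have h2 := card_erase_of_mem hv'
        have h3 : 0 < #P := card_pos.2 ⟨u, hu⟩
        have h4 : 0 < #(P.erase u) := card_pos.2 ⟨v, hv'⟩
        omega

lemma exists_common_neighbor {ι : Type*} {Γ : SimpleGraph ι} {P : Finset ι} {D : ℕ} {u v : ι}
    (hu : #{x ∈ P | ¬ Γ.Adj u x} ≤ D) (hv : #{x ∈ P | ¬ Γ.Adj v x} ≤ D) (hP : 2 * D < #P) :
    ∃ x ∈ P, Γ.Adj u x ∧ Γ.Adj v x := by
  have h1 := card_union_le {x ∈ P | ¬ Γ.Adj u x} {x ∈ P | ¬ Γ.Adj v x}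
  obtain ⟨x, hx, hx'⟩ := exists_mem_notMem_of_card_lt_card (h1.trans_lt (by omega) : _ < #P)
  simp only [mem_union, mem_filter, hx, true_and, not_or, not_not] at hx'
  exact ⟨x, hx, hx'⟩

/-- A nearly complete subgraph contains a large odd connected matching. -/
lemma hasOddConnectedMatching_of_dense {ι : Type*} {Γ : SimpleGraph ι} {P : Finset ι} {D : ℕ}
    (hD : ∀ u ∈ P, #{x ∈ P | ¬ Γ.Adj u x} ≤ D) (hP : 2 * D < #P) :
    HasOddConnectedMatching Γ (2 * (#P - D)) := by
  obtain ⟨r, hr⟩ : P.Nonempty := card_pos.1 (by omega)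
  obtain ⟨u, hu, hru, -⟩ := exists_common_neighbor (hD r hr) (hD r hr) hP
  obtain ⟨x, hx, hrx, hux⟩ := exists_common_neighbor (hD r hr) (hD u hu) hP
  obtain ⟨M, Q, hM, hQ, hMa, hQi, hc⟩ := exists_maximal_pairMatching Γ P
  have hQD : #Q ≤ D := by
    rcases Q.eq_empty_or_nonempty with rfl | ⟨q, hq⟩
    · simp
    · refine (card_le_card ?_).trans (hD q (hQ hq))
      exact fun y hy ↦ mem_filter.2 ⟨hQ hy, hQi q hq y hy⟩
  refine ⟨r, ⟨.cons hru (.cons hux (.cons hrx.symm .nil)), by simp; decide⟩, M, hM,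
    fun e he ↦ ⟨(hMa e he).1, ?_⟩, by omega⟩
  obtain ⟨y, -, hry, hey⟩ := exists_common_neighbor (hD r hr) (hD e.1 (hMa e he).2.1) hP
  exact hry.reachable.trans hey.reachable.symm

lemma hasOddConnectedMatching_of_connected {ι : Type*} {R B : SimpleGraph ι} {X : Finset ι}
    {K D : ℕ} (hD : ∀ u ∈ X, #{x ∈ X | ¬ R.Adj u x ∧ ¬ B.Adj u x} ≤ D)
    (hX : K ≤ #X + 2 * D) (hK : 8 * D < K)
    (hconn : ∀ u ∈ X, ∀ v ∈ X, R.Reachable u v) :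
    HasOddConnectedMatching R (K - 4 * D) ∨ HasOddConnectedMatching B (K - 4 * D) := by
  have indep : ∀ Q ⊆ X, #X ≤ 2 * #Q → (∀ u ∈ Q, ∀ v ∈ Q, ¬ R.Adj u v) →
      HasOddConnectedMatching B (K - 4 * D) := by
    intro Q hQ hcard hind
    refine (hasOddConnectedMatching_of_dense (P := Q) (D := D) (fun u hu ↦ ?_) (by omega)).mono
      (by omega)
    refine (card_le_card ?_).trans (hD u (hQ hu))
    intro x hx
    rw [mem_filter] at hx ⊢
    exact ⟨hQ hx.1, hind u hu x hx.1, hx.2⟩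
  obtain ⟨r, hr⟩ : X.Nonempty := card_pos.1 (by omega)
  by_cases hodd : ∃ w : R.Walk r r, Odd w.length
  · obtain ⟨M, Q, hM, hQ, hMa, hQi, hc⟩ := exists_maximal_pairMatching R X
    by_cases hQX : #X ≤ 2 * #Q
    · exact Or.inr (indep Q hQ hQX hQi)
    · exact Or.inl ⟨r, hodd, M, hM,
        fun e he ↦ ⟨(hMa e he).1, hconn r hr _ (hMa e he).2.1⟩, by omega⟩
  · right
    have hsplit : X ⊆ {v ∈ X | ∃ w : R.Walk r v, Even w.length} ∪
        {v ∈ X | ∃ w : R.Walk r v, Odd w.length} := by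
      intro v hv
      obtain ⟨w⟩ := hconn r hr v hv
      rcases Nat.even_or_odd w.length with h | h
      · exact mem_union_left _ (mem_filter.2 ⟨hv, w, h⟩)
      · exact mem_union_right _ (mem_filter.2 ⟨hv, w, h⟩)
    have hcard := (card_le_card hsplit).trans (card_union_le _ _)
    rcases le_total (#{v ∈ X | ∃ w : R.Walk r v, Even w.length})
      (#{v ∈ X | ∃ w : R.Walk r v, Odd w.length}) with hle | hle
    · refine indep {v ∈ X | ∃ w : R.Walk r v, Odd w.length} (filter_subset _ _) (by omega)
        fun u hu v hv huv ↦ hodd ?_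
      obtain ⟨-, p, hp⟩ := mem_filter.1 hu
      obtain ⟨-, q, hq⟩ := mem_filter.1 hv
      refine ⟨p.append (.cons huv q.reverse), ?_⟩
      simp only [SimpleGraph.Walk.length_append, SimpleGraph.Walk.length_cons,
        SimpleGraph.Walk.length_reverse]
      grind
    · refine indep {v ∈ X | ∃ w : R.Walk r v, Even w.length} (filter_subset _ _) (by omega)
        fun u hu v hv huv ↦ hodd ?_
      obtain ⟨-, p, hp⟩ := mem_filter.1 hu
      obtain ⟨-, q, hq⟩ := mem_filter.1 hv
      refine ⟨p.append (.cons huv q.reverse), ?_⟩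
      simp only [SimpleGraph.Walk.length_append, SimpleGraph.Walk.length_cons,
        SimpleGraph.Walk.length_reverse]
      grind

/-- In a nearly complete graph whose edges are covered by `R` and `B`, one of these two graphs
connects almost all vertices. -/
lemma exists_reachable_subset {ι : Type*} {R B : SimpleGraph ι} {U : Finset ι} {D : ℕ}
    (hD : ∀ u ∈ U, #{x ∈ U | ¬ R.Adj u x ∧ ¬ B.Adj u x} ≤ D) (hU : 8 * D < #U) :
    (∃ X ⊆ U, #U ≤ #X + 2 * D ∧ ∀ u ∈ X, ∀ v ∈ X, R.Reachable u v) ∨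
      ∀ u ∈ U, ∀ v ∈ U, B.Reachable u v := by
  have hne : {X ∈ U.powerset | 2 * D < #X ∧ ∀ x ∈ X, ∀ y ∈ U \ X, ¬ R.Adj x y}.Nonempty :=
    ⟨U, mem_filter.2 ⟨mem_powerset.2 subset_rfl, by omega, by simp⟩⟩
  obtain ⟨X, hX, hmin⟩ := exists_min_image _ card hne
  simp only [mem_filter, mem_powerset] at hX hmin
  obtain ⟨hXU, hXD, hXc⟩ := hX
  by_cases hlarge : 2 * D < #(U \ X)
  · right
    have key : ∀ Y ⊆ U, 2 * D < #Y → ∀ u ∈ U, ∀ v ∈ U, (∀ y ∈ Y, ¬ R.Adj u y) →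
        (∀ y ∈ Y, ¬ R.Adj v y) → ∃ x ∈ Y, B.Adj u x ∧ B.Adj v x := by
      intro Y hY hYD u hu v hv h1 h2
      refine exists_common_neighbor ((card_le_card ?_).trans (hD u hu))
        ((card_le_card ?_).trans (hD v hv)) hYD
      · intro x hx
        rw [mem_filter] at hx ⊢
        exact ⟨hY hx.1, h1 x hx.1, hx.2⟩
      · intro x hx
        rw [mem_filter] at hx ⊢
        exact ⟨hY hx.1, h2 x hx.1, hx.2⟩
    have hXX : ∀ u ∈ X, ∀ v ∈ X, B.Reachable u v := by
      intro u hu v hv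
      obtain ⟨x, -, h1, h2⟩ := key (U \ X) sdiff_subset hlarge u (hXU hu) v (hXU hv)
        (hXc u hu) (hXc v hv)
      exact h1.reachable.trans h2.reachable.symm
    have hYX : ∀ u ∈ U \ X, ∃ x ∈ X, B.Adj u x := by
      intro u hu
      have h : ∀ y ∈ X, ¬ R.Adj u y := fun y hy hadj ↦ hXc y hy u hu hadj.symm
      obtain ⟨x, hx, h1, -⟩ := key X hXU hXD u (mem_sdiff.1 hu).1 u (mem_sdiff.1 hu).1 h h
      exact ⟨x, hx, h1⟩
    have hUX : ∀ u ∈ U, ∃ x ∈ X, B.Reachable u x := by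
      intro u hu
      by_cases huX : u ∈ X
      · exact ⟨u, huX, .rfl⟩
      · obtain ⟨x, hx, h⟩ := hYX u (mem_sdiff.2 ⟨hu, huX⟩)
        exact ⟨x, hx, h.reachable⟩
    intro u hu v hv
    obtain ⟨x, hx, h1⟩ := hUX u hu
    obtain ⟨y, hy, h2⟩ := hUX v hv
    exact h1.trans ((hXX x hx y hy).trans h2.symm)
  · left
    have hcard := card_sdiff_add_card_eq_card hXU
    refine ⟨X, hXU, by omega, fun u hu v hv ↦ ?_⟩
    by_contra huv
    have c1 := hmin {y ∈ X | R.Reachable u y}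
    have c2 := hmin {y ∈ X | ¬ R.Reachable u y}
    have hsum := card_filter_add_card_filter_not (s := X) (fun y ↦ R.Reachable u y)
    have p1 : 0 < #{y ∈ X | R.Reachable u y} := card_pos.2 ⟨u, mem_filter.2 ⟨hu, .rfl⟩⟩
    have p2 : 0 < #{y ∈ X | ¬ R.Reachable u y} := card_pos.2 ⟨v, mem_filter.2 ⟨hv, huv⟩⟩
    have d1 : ¬ 2 * D < #{y ∈ X | R.Reachable u y} := by
      intro h
      have := c1 ⟨(filter_subset _ _).trans hXU, h, fun x hx y hy hxy ↦ ?_⟩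
      · omega
      · simp only [mem_filter, mem_sdiff, not_and] at hx hy
        by_cases hyX : y ∈ X
        · exact hy.2 hyX (hx.2.trans hxy.reachable)
        · exact hXc x hx.1 y (mem_sdiff.2 ⟨hy.1, hyX⟩) hxy
    have d2 : ¬ 2 * D < #{y ∈ X | ¬ R.Reachable u y} := by
      intro h
      have := c2 ⟨(filter_subset _ _).trans hXU, h, fun x hx y hy hxy ↦ ?_⟩
      · omega
      · simp only [mem_filter, mem_sdiff, not_and, not_not] at hx hy
        by_cases hyX : y ∈ X
        · exact hx.2 ((hy.2 hyX).trans hxy.reachable.symm)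
        · exact hXc x hx.1 y (mem_sdiff.2 ⟨hy.1, hyX⟩) hxy
    omega

lemma hasOddConnectedMatching_or {ι : Type*} {R B : SimpleGraph ι} {U : Finset ι} {D : ℕ}
    (hD : ∀ u ∈ U, #{x ∈ U | ¬ R.Adj u x ∧ ¬ B.Adj u x} ≤ D) (hU : 8 * D < #U) :
    HasOddConnectedMatching R (#U - 4 * D) ∨ HasOddConnectedMatching B (#U - 4 * D) := by
  rcases exists_reachable_subset hD hU with ⟨X, hXU, hX, hc⟩ | hc
  · refine hasOddConnectedMatching_of_connected (fun u hu ↦ ?_) hX hU hc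
    exact (card_le_card (filter_subset_filter _ hXU)).trans (hD u (hXU hu))
  · refine (hasOddConnectedMatching_of_connected (R := B) (B := R) (X := U) (D := D)
      (fun u hu ↦ ?_) (by omega) hU hc).symm
    simpa only [and_comm] using hD u hu

lemma sum_simpleGraph_prod_edges {N : ℕ} (a b : Sym2 (Fin N) → ℝ) :
    ∑ G : SimpleGraph (Fin N), (∏ e ∈ G.edgeFinset, a e) *
      ∏ e ∈ (⊤ : SimpleGraph (Fin N)).edgeFinset \ G.edgeFinset, b e =
    ∏ e ∈ (⊤ : SimpleGraph (Fin N)).edgeFinset, (a e + b e) := by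
  rw [prod_add]
  refine sum_bij' (fun G _ ↦ G.edgeFinset) (fun S _ ↦ SimpleGraph.fromEdgeSet S) ?_ ?_ ?_ ?_ ?_
  · intro G _
    exact mem_powerset.2 (SimpleGraph.edgeFinset_mono le_top)
  · simp
  · intro G _
    simp
  · intro S hS
    ext e
    have := fun h : e ∈ S ↦ mem_powerset.1 hS h
    simp only [SimpleGraph.mem_edgeFinset, SimpleGraph.edgeSet_fromEdgeSet,
      SimpleGraph.edgeSet_top, Set.mem_sdiff, mem_coe] at this ⊢
    exact ⟨fun h ↦ h.1, fun h ↦ ⟨h, this h⟩⟩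
  · intro G _
    rfl

lemma card_interedges_eq_card_filter_edgeFinset {V : Type*} (G : SimpleGraph V)
    [Fintype G.edgeSet] [DecidableRel G.Adj] {X Y : Finset V} (hXY : Disjoint X Y)
    {C : Sym2 V → Prop} [DecidablePred C] (hC : ∀ e, C e ↔ ∃ x ∈ X, ∃ y ∈ Y, e = s(x, y)) :
    #(G.interedges X Y) = #{e ∈ G.edgeFinset | C e} := by
  rw [← card_image_of_injOn (s := G.interedges X Y) (f := fun e : V × V ↦ s(e.1, e.2))]
  · congr 1
    ext e
    simp only [mem_image, SimpleGraph.mem_interedges_iff, mem_filter, SimpleGraph.mem_edgeFinset,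
      Prod.exists, hC]
    constructor
    · rintro ⟨x, y, ⟨hx, hy, h⟩, rfl⟩
      exact ⟨h, x, hx, y, hy, rfl⟩
    · rintro ⟨h, x, hx, y, hy, rfl⟩
      exact ⟨x, y, ⟨hx, hy, h⟩, rfl⟩
  · rintro ⟨x, y⟩ h ⟨x', y'⟩ h' heq
    simp only [mem_coe, SimpleGraph.mem_interedges_iff] at h h'
    rcases Sym2.eq_iff.1 heq with ⟨h1, h2⟩ | ⟨h1, h2⟩
    · exact Prod.ext h1 h2
    · exact absurd h'.2.1 (disjoint_left.1 hXY (show y' ∈ X from (show x = y' from h1) ▸ h.1))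

/-- The probability of a single graph in the binomial model. -/
noncomputable def graphWeight (N : ℕ) (p : ℝ) (G : SimpleGraph (Fin N)) : ℝ :=
  p ^ (Nat.card G.edgeSet) * (1 - p) ^ (N.choose 2 - Nat.card G.edgeSet)

lemma graphWeight_nonneg {N : ℕ} {p : ℝ} (hp0 : 0 ≤ p) (hp1 : p ≤ 1) (G : SimpleGraph (Fin N)) :
    0 ≤ graphWeight N p G := by
  have : 0 ≤ 1 - p := by linarith
  unfold graphWeight
  positivity

lemma graphWeight_eq (N : ℕ) (p : ℝ) (G : SimpleGraph (Fin N)) :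
    graphWeight N p G = (∏ _e ∈ G.edgeFinset, p) *
      ∏ _e ∈ (⊤ : SimpleGraph (Fin N)).edgeFinset \ G.edgeFinset, (1 - p) := by
  rw [prod_const, prod_const, card_sdiff_of_subset (SimpleGraph.edgeFinset_mono le_top),
    SimpleGraph.card_edgeFinset_top_eq_card_choose_two, Fintype.card_fin, graphWeight,
    Nat.card_eq_fintype_card, ← SimpleGraph.edgeFinset_card]

lemma sum_graphWeight (N : ℕ) (p : ℝ) : ∑ G : SimpleGraph (Fin N), graphWeight N p G = 1 := by
  simp_rw [graphWeight_eq]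
  rw [sum_simpleGraph_prod_edges]
  simp

lemma sum_graphWeight_mul_exp (N : ℕ) (p : ℝ) {X Y : Finset (Fin N)} (hXY : Disjoint X Y) :
    ∑ G : SimpleGraph (Fin N), graphWeight N p G * Real.exp (-#(G.interedges X Y)) =
      (1 - p * (1 - Real.exp (-1))) ^ (#X * #Y) := by
  set C : Sym2 (Fin N) → Prop := fun e ↦ ∃ x ∈ X, ∃ y ∈ Y, e = s(x, y)
  have hC : ∀ e, C e ↔ ∃ x ∈ X, ∃ y ∈ Y, e = s(x, y) := fun _ ↦ Iff.rfl
  have h : ∀ G : SimpleGraph (Fin N), graphWeight N p G * Real.exp (-#(G.interedges X Y)) =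
      (∏ e ∈ G.edgeFinset, (p * if C e then Real.exp (-1) else 1)) *
      ∏ _e ∈ (⊤ : SimpleGraph (Fin N)).edgeFinset \ G.edgeFinset, (1 - p) := by
    intro G
    rw [prod_mul_distrib, graphWeight_eq, prod_ite, prod_const_one, mul_one,
      prod_const (Real.exp (-1)),
      ← card_interedges_eq_card_filter_edgeFinset G hXY hC, ← Real.exp_nat_mul]
    ring_nf
  simp_rw [h]
  rw [sum_simpleGraph_prod_edges]
  have h2 : ∀ e, (p * if C e then Real.exp (-1) else 1) + (1 - p) =
      if C e then 1 - p * (1 - Real.exp (-1)) else 1 := by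
    intro e; split_ifs <;> ring
  simp_rw [h2]
  rw [prod_ite, prod_const_one, mul_one, prod_const,
    ← card_interedges_eq_card_filter_edgeFinset ⊤ hXY hC]
  congr 1
  rw [SimpleGraph.interedges_def, ← card_product]
  congr 1
  rw [filter_eq_self]
  intro e he
  rw [mem_product] at he
  exact fun h ↦ disjoint_left.1 hXY he.1 (h ▸ he.2)

lemma sum_graphWeight_sparse_le {N : ℕ} {p : ℝ} (hp0 : 0 ≤ p) (hp1 : p ≤ 1)
    {X Y : Finset (Fin N)} (hXY : Disjoint X Y) :
    ∑ G : SimpleGraph (Fin N),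
      (if (#(G.interedges X Y) : ℝ) < p / 4 * #X * #Y then graphWeight N p G else 0) ≤
      Real.exp (-(p / 4 * #X * #Y)) := by
  have hexp : Real.exp (-1) ≤ 1 / 2 := by
    rw [Real.exp_neg, ← one_div]
    exact one_div_le_one_div_of_le (by norm_num) (by linarith [Real.add_one_le_exp 1])
  have hexp0 := Real.exp_pos (-1)
  have hbase : 1 - p * (1 - Real.exp (-1)) ≤ Real.exp (-(p / 2)) := by
    refine le_trans ?_ (Real.add_one_le_exp _)
    nlinarith
  have hbase0 : 0 ≤ 1 - p * (1 - Real.exp (-1)) := by nlinarith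
  calc _ ≤ ∑ G : SimpleGraph (Fin N), Real.exp (p / 4 * #X * #Y) *
        (graphWeight N p G * Real.exp (-#(G.interedges X Y))) := by
        refine sum_le_sum fun G _ ↦ ?_
        have hw := graphWeight_nonneg hp0 hp1 G
        split_ifs with h
        · have : 1 ≤ Real.exp (p / 4 * #X * #Y) * Real.exp (-#(G.interedges X Y)) := by
            rw [← Real.exp_add]
            exact Real.one_le_exp (by linarith)
          nlinarith
        · positivity
    _ = Real.exp (p / 4 * #X * #Y) * (1 - p * (1 - Real.exp (-1))) ^ (#X * #Y) := by
        rw [← mul_sum, sum_graphWeight_mul_exp N p hXY]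
    _ ≤ Real.exp (p / 4 * #X * #Y) * Real.exp (-(p / 2)) ^ (#X * #Y) := by gcongr
    _ = Real.exp (-(p / 4 * #X * #Y)) := by
        rw [← Real.exp_nat_mul, ← Real.exp_add]
        push_cast
        ring_nf

/-- All pairs of disjoint sets of at least `m` vertices have density at least `q`. -/
def UniformlyDense {V : Type*} (G : SimpleGraph V) (q m : ℝ) : Prop :=
  ∀ X Y : Finset V, Disjoint X Y → m ≤ #X → m ≤ #Y → q * #X * #Y ≤ #(G.interedges X Y)

lemma le_graphProbability {N : ℕ} {p : ℝ} (hp0 : 0 ≤ p) (hp1 : p ≤ 1) {m : ℝ} (hm : 0 ≤ m)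
    {E : Set (SimpleGraph (Fin N))} (hE : ∀ G, UniformlyDense G (p / 4) m → G ∈ E) :
    1 - 4 ^ N * Real.exp (-(p / 4 * m * m)) ≤ graphProbability N p E := by
  set bad : Finset (Fin N) × Finset (Fin N) → SimpleGraph (Fin N) → ℝ := fun z G ↦
    if Disjoint z.1 z.2 ∧ m ≤ #z.1 ∧ m ≤ #z.2 ∧
      (#(G.interedges z.1 z.2) : ℝ) < p / 4 * #z.1 * #z.2 then graphWeight N p G else 0 with hbad
  have hbad0 : ∀ z G, 0 ≤ bad z G := by
    intro z G
    have := graphWeight_nonneg hp0 hp1 G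
    simp only [hbad]
    split_ifs <;> simp [this]
  have h1 : ∀ G, graphWeight N p G ≤ (if G ∈ E then graphWeight N p G else 0) + ∑ z, bad z G := by
    intro G
    by_cases hG : UniformlyDense G (p / 4) m
    · rw [if_pos (hE G hG)]
      have := sum_nonneg (s := univ) fun z _ ↦ hbad0 z G
      linarith
    · unfold UniformlyDense at hG
      push Not at hG
      obtain ⟨X, Y, h1, h2, h3, h4⟩ := hG
      have hle := single_le_sum (f := fun z ↦ bad z G) (fun z _ ↦ hbad0 z G) (mem_univ (X, Y))
      have : bad (X, Y) G = graphWeight N p G := if_pos ⟨h1, h2, h3, h4⟩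
      have h0 : 0 ≤ if G ∈ E then graphWeight N p G else 0 := by
        have := graphWeight_nonneg hp0 hp1 G
        split_ifs <;> simp [this]
      linarith
  have h2 : ∀ z, ∑ G, bad z G ≤ Real.exp (-(p / 4 * m * m)) := by
    intro z
    by_cases hz : Disjoint z.1 z.2 ∧ m ≤ #z.1 ∧ m ≤ #z.2
    · refine le_trans (le_of_eq ?_) ((sum_graphWeight_sparse_le hp0 hp1 hz.1).trans ?_)
      · simp [hbad, hz.1, hz.2.1, hz.2.2]
      · refine Real.exp_le_exp.2 (neg_le_neg ?_)
        have := hz.2.1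
        have := hz.2.2
        gcongr
    · have : ∀ G, bad z G = 0 := fun G ↦ if_neg fun h ↦ hz ⟨h.1, h.2.1, h.2.2.1⟩
      simp only [this, sum_const_zero]
      positivity
  have h3 := sum_le_sum fun G (_ : G ∈ (univ : Finset (SimpleGraph (Fin N)))) ↦ h1 G
  rw [sum_graphWeight, sum_add_distrib, sum_comm] at h3
  have h4 := sum_le_sum fun z (_ : z ∈ (univ : Finset (Finset (Fin N) × Finset (Fin N)))) ↦ h2 z
  rw [sum_const, card_univ, Fintype.card_prod, Fintype.card_finset, Fintype.card_fin,
    ← mul_pow, nsmul_eq_mul] at h4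
  norm_num at h4
  have h5 : graphProbability N p E = ∑ G, if G ∈ E then graphWeight N p G else 0 := rfl
  rw [h5]
  linarith

lemma exists_le_graphProbability {p : ℝ} (hp0 : 0 < p) (hp1 : p ≤ 1) {η ε : ℝ} (hη : 0 < η)
    (hε : 0 < ε) : ∃ N₀ : ℕ, ∀ N ≥ N₀, ∀ E : Set (SimpleGraph (Fin N)),
      (∀ G, UniformlyDense G (p / 4) (η * N) → G ∈ E) → 1 - ε ≤ graphProbability N p E := by
  obtain ⟨N₁, hN₁⟩ := exists_nat_ge (3 / (p / 4 * η * η))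
  obtain ⟨N₂, hN₂⟩ := exists_nat_ge (1 / ε)
  refine ⟨max N₁ N₂, fun N hN E hE ↦ ?_⟩
  refine le_trans ?_ (le_graphProbability hp0.le hp1 (by positivity) hE)
  have hc : 0 < p / 4 * η * η := by positivity
  have h1 : 3 ≤ p / 4 * η * η * N := by
    have : (N₁ : ℝ) ≤ N := by exact_mod_cast (le_max_left _ _).trans hN
    have := hN₁.trans this
    rw [div_le_iff₀ hc] at this
    linarith
  have h2 : 1 / ε ≤ N := hN₂.trans (by exact_mod_cast (le_max_right _ _).trans hN)
  have h3 : (4 : ℝ) ≤ Real.exp 2 := by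
    have := Real.add_one_le_exp 1
    have h : Real.exp 2 = Real.exp 1 * Real.exp 1 := by rw [← Real.exp_add]; norm_num
    nlinarith
  have h4 : (4 : ℝ) ^ N * Real.exp (-(p / 4 * (η * N) * (η * N))) ≤ Real.exp (-N) := by
    calc _ ≤ Real.exp 2 ^ N * Real.exp (-(p / 4 * (η * N) * (η * N))) := by gcongr
      _ = Real.exp (N * 2 + -(p / 4 * (η * N) * (η * N))) := by
        rw [← Real.exp_nat_mul, ← Real.exp_add]
      _ ≤ _ := by
        refine Real.exp_le_exp.2 ?_
        have : (0 : ℝ) ≤ N := by positivity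
        nlinarith
  have h5 : Real.exp (-N) ≤ ε := by
    rw [Real.exp_neg]
    have h6 := Real.add_one_le_exp (N : ℝ)
    rw [div_le_iff₀ hε] at h2
    rw [inv_le_comm₀ (Real.exp_pos _) hε, ← one_div, div_le_iff₀ hε]
    nlinarith
  linarith

/-- The graph of the edges of color `i`. -/
def colorGraph {V : Type*} (F : SimpleGraph V) {k : ℕ} (c : F.edgeSet → Fin k) (i : Fin k) :
    SimpleGraph V where
  Adj u v := ∃ h : s(u, v) ∈ F.edgeSet, c ⟨s(u, v), h⟩ = i
  symm := ⟨by
    rintro u v ⟨h, hc⟩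
    have : s(v, u) = s(u, v) := Sym2.eq_swap
    exact ⟨this ▸ h, by simpa only [this] using hc⟩⟩
  loopless := ⟨fun v ⟨h, _⟩ ↦ F.loopless.irrefl v h⟩

lemma colorGraph_le {V : Type*} (F : SimpleGraph V) {k : ℕ} (c : F.edgeSet → Fin k) (i : Fin k) :
    colorGraph F c i ≤ F :=
  fun _ _ h ↦ h.1

lemma hasMonoCycle_of_isCycle {V : Type*} {F : SimpleGraph V} {k : ℕ} {c : F.edgeSet → Fin k}
    {i : Fin k} {v : V} {w : (colorGraph F c i).Walk v v} (hw : w.IsCycle) :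
    HasMonoCycle F c i w.length := by
  refine ⟨v, w.mapLe (colorGraph_le F c i), hw.mapLe _, by simp, fun e h ↦ ?_⟩
  have he : e ∈ (colorGraph F c i).edgeSet := w.edges_subset_edgeSet (by simpa using h)
  induction e using Sym2.ind with
  | _ x y => exact he.2

lemma LowerDense.symm {V : Type*} {H : SimpleGraph V} {d : ℝ} {t : ℕ} {A B : Finset V}
    (h : LowerDense H d t A B) : LowerDense H d t B A := by
  have : Std.Symm H.Adj := ⟨fun _ _ h ↦ h.symm⟩
  intro X hX Y hY hXt hYt
  have h1 := h Y hY X hX hYt hXt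
  have h2 : #(H.interedges Y X) = #(H.interedges X Y) := Rel.card_interedges_comm Y X
  rw [h2] at h1
  linarith

lemma lowerDense_or_of_isUniform {V : Type*} {F R B : SimpleGraph V} (hF : F ≤ R ⊔ B)
    {d ε m : ℝ} {t : ℕ} {X₀ Y₀ : Finset V} (hεd : ε ≤ d)
    (hdense : UniformlyDense F (4 * d) m) (hXY : Disjoint X₀ Y₀) (hunif : R.IsUniform ε X₀ Y₀)
    (ht : 0 < t) (hX₀ : #X₀ * ε ≤ t) (hY₀ : #Y₀ * ε ≤ t) (hm : m ≤ t) :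
    LowerDense R d t X₀ Y₀ ∨ LowerDense B d t X₀ Y₀ := by
  have hdens : ∀ X Y : Finset V, t ≤ #X → t ≤ #Y →
      (#(R.interedges X Y) : ℝ) = R.edgeDensity X Y * (#X * #Y) := by
    intro X Y hX hY
    have h1 : (0 : ℝ) < #X := by exact_mod_cast ht.trans_le hX
    have h2 : (0 : ℝ) < #Y := by exact_mod_cast ht.trans_le hY
    rw [SimpleGraph.edgeDensity_def]
    push_cast
    field_simp
  by_cases h : 2 * d ≤ R.edgeDensity X₀ Y₀
  · left
    intro X hX Y hY hXt hYt
    have hu := hunif hX hY (hX₀.trans (by exact_mod_cast hXt)) (hY₀.trans (by exact_mod_cast hYt))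
    rw [abs_lt] at hu
    rw [hdens X Y hXt hYt, mul_assoc]
    gcongr
    linarith
  · right
    intro X hX Y hY hXt hYt
    have hu := hunif hX hY (hX₀.trans (by exact_mod_cast hXt)) (hY₀.trans (by exact_mod_cast hYt))
    rw [abs_lt] at hu
    have hR : (#(R.interedges X Y) : ℝ) ≤ 3 * d * (#X * #Y) := by
      rw [hdens X Y hXt hYt]
      gcongr
      linarith
    have hFXY := hdense X Y (disjoint_of_subset_left hX (disjoint_of_subset_right hY hXY))
      (hm.trans (by exact_mod_cast hXt)) (hm.trans (by exact_mod_cast hYt))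
    have hsub : F.interedges X Y ⊆ R.interedges X Y ∪ B.interedges X Y := by
      rintro ⟨x, y⟩ h
      simp only [mem_union, SimpleGraph.mem_interedges_iff] at h ⊢
      rcases hF h.2.2 with h' | h'
      · exact Or.inl ⟨h.1, h.2.1, h'⟩
      · exact Or.inr ⟨h.1, h.2.1, h'⟩
    have hcard : (#(F.interedges X Y) : ℝ) ≤ #(R.interedges X Y) + #(B.interedges X Y) := by
      exact_mod_cast (card_le_card hsub).trans (card_union_le _ _)
    linarith

/-- The cluster graph of the pairs of dense clusters. -/
def clusterGraph {ι V : Type*} (H : SimpleGraph V) (d : ℝ) (t : ℕ) (W : ι → Finset V) :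
    SimpleGraph ι where
  Adj i j := i ≠ j ∧ LowerDense H d t (W i) (W j)
  symm := ⟨fun _ _ h ↦ ⟨h.1.symm, h.2.symm⟩⟩
  loopless := ⟨fun _ h ↦ h.1 rfl⟩

lemma exists_isCycle_of_hasOddConnectedMatching {ι V : Type*} {H : SimpleGraph V} {d : ℝ}
    {s t L n m a : ℕ} {W : ι → Finset V} (ht : 0 < t) (hdt : 1 ≤ d * t) (hds : t ≤ d * s)
    (hts : t ≤ s) (hdisj : ∀ a b, a ≠ b → Disjoint (W a) (W b)) (hm : ∀ i, m ≤ #(W i))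
    (hL : ∀ r, (∃ w : (clusterGraph H d t W).Walk r r, Odd w.length) →
      ∃ w : (clusterGraph H d t W).Walk r r, Odd w.length ∧ w.length ≤ L ∧
        ∀ v, (clusterGraph H d t W).Reachable r v → v ∈ w.support)
    (hM : HasOddConnectedMatching (clusterGraph H d t W) n) (ha : a + L + 2 * s + 2 ≤ m)
    {l : ℕ} (hl : Odd l) (hl3 : 3 ≤ l) (hLl : L ≤ l) (hla : 2 * l ≤ n * a) :
    ∃ (x : V) (c : H.Walk x x), c.IsCycle ∧ c.length = l := by
  obtain ⟨r, hr, M, hM, hMa, hn⟩ := hM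
  obtain ⟨w, hw, hwL, hv⟩ := hL r hr
  obtain ⟨w', hl', hc⟩ := exists_walk_of_matching w a M (fun e he ↦ (hMa e he).1)
    (fun e he ↦ hv _ (hMa e he).2) ((l - w.length) / 2)
    (by nlinarith [Nat.div_mul_le_self (l - w.length) 2, Nat.sub_le l w.length])
  have hlen : w'.length = l := by
    obtain ⟨x, hx⟩ := hw
    obtain ⟨y, hy⟩ := hl
    omega
  obtain ⟨x, c, hcyc, hcl⟩ := exists_isCycle_of_closed_walk ht hdt hds hts hdisj
    (fun i j (h : (clusterGraph H d t W).Adj i j) ↦ h.2) w' (by omega) (by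
      intro i
      have h1 := (hc i).2
      have h2 := Nat.mul_le_mul_right a (hM i)
      have h3 := w.support.count_le_length (a := i)
      rw [SimpleGraph.Walk.length_support] at h3
      have h4 := hm i
      omega)
  exact ⟨x, c, hcyc, hcl.trans hlen⟩

lemma exists_nearly_regular_subset {N : ℕ} {R : SimpleGraph (Fin N)} {ε κ : ℝ} (hκ : 0 < κ)
    (hε : ε ≤ κ * κ) {P : Finpartition (univ : Finset (Fin N))} (hP : P.IsUniform R ε)
    {k : ℕ} (hk : k = #P.parts) (hk0 : 0 < k) (e : Fin k ≃ P.parts) :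
    ∃ U : Finset (Fin k), k - κ * k ≤ #U ∧
      ∀ i ∈ U, (#{j | i ≠ j ∧ ¬ R.IsUniform ε (e i : Finset (Fin N)) (e j)} : ℝ) ≤ κ * k := by
  set f : Fin k → ℕ := fun i ↦ #{j | i ≠ j ∧ ¬ R.IsUniform ε (e i : Finset (Fin N)) (e j)} with hf
  have hk0' : (0 : ℝ) < k := by exact_mod_cast hk0
  have hsum : ∑ i, f i ≤ #(P.nonUniforms R ε) := by
    simp only [hf]
    rw [← card_sigma]
    refine card_le_card_of_injOn (fun x ↦ ((e x.1 : Finset (Fin N)), (e x.2 : Finset (Fin N)))) ?_ ?_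
    · rintro ⟨i, j⟩ hij
      simp only [coe_sigma, Set.mem_sigma_iff, mem_coe, mem_filter, mem_univ, true_and] at hij
      simp only [mem_coe, Finpartition.mk_mem_nonUniforms]
      refine ⟨(e i).2, (e j).2, fun h ↦ hij.1 (e.injective (Subtype.ext h)), hij.2⟩
    · rintro ⟨i, j⟩ - ⟨i', j'⟩ - h
      simp only [Prod.mk.injEq] at h
      have h1 := e.injective (Subtype.ext h.1)
      have h2 := e.injective (Subtype.ext h.2)
      subst h1 h2
      rfl
  have hnu : (#(P.nonUniforms R ε) : ℝ) ≤ k * k * (κ * κ) := by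
    refine hP.trans ?_
    rw [← hk]
    have : ((k * (k - 1) : ℕ) : ℝ) ≤ k * k := by exact_mod_cast Nat.mul_le_mul_left k (Nat.sub_le k 1)
    calc _ ≤ ((k * (k - 1) : ℕ) : ℝ) * (κ * κ) := by gcongr
      _ ≤ _ := by gcongr
  refine ⟨univ.filter fun i ↦ (f i : ℝ) ≤ κ * k, ?_, fun i hi ↦ (mem_filter.1 hi).2⟩
  have hbad : (#{i | ¬ (f i : ℝ) ≤ κ * k} : ℝ) * (κ * k) ≤ k * k * (κ * κ) := by
    refine le_trans ?_ hnu
    refine le_trans ?_ (Nat.cast_le.2 hsum)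
    push_cast
    rw [← nsmul_eq_mul]
    refine (card_nsmul_le_sum {i | ¬ (f i : ℝ) ≤ κ * k} (fun i ↦ (f i : ℝ)) _
      (fun i hi ↦ (not_le.1 (mem_filter.1 hi).2).le)).trans ?_
    exact sum_le_sum_of_subset_of_nonneg (filter_subset _ _) fun _ _ _ ↦ by positivity
  have hbad' : (#{i | ¬ (f i : ℝ) ≤ κ * k} : ℝ) ≤ κ * k := by
    have : 0 < κ * k := by positivity
    refine le_of_mul_le_mul_right ?_ this
    linarith
  have htot := card_filter_add_card_filter_not (s := (univ : Finset (Fin k)))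
    (fun i ↦ (f i : ℝ) ≤ κ * k)
  rw [card_univ, Fintype.card_fin] at htot
  have : (#{i | (f i : ℝ) ≤ κ * k} : ℝ) + #{i | ¬ (f i : ℝ) ≤ κ * k} = k := by exact_mod_cast htot
  linarith

lemma four_mul_add_two_le_of_clusters {κ δ k m n₁ N : ℝ} (hδ : 0 < δ) (hδ1 : δ ≤ 1)
    (hκ : κ = δ / 1000) (hk0 : 0 ≤ k) (hm0 : 0 ≤ m) (hn0 : 0 ≤ n₁) (hκm : 1 ≤ κ * m)
    (hn₁ : 4 ≤ δ * n₁) (hN : (4 + δ) * n₁ ≤ N) (hNk : N ≤ k * (m + 1)) :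
    4 * n₁ + 2 ≤ (1 - 9 * κ) * k * ((1 - κ) * m) := by
  have hκ1 : κ ≤ 1 / 1000 := by rw [hκ]; linarith
  have hκ0 : 0 < κ := by rw [hκ]; positivity
  have h3 : N ≤ k * m * (1 + κ) := by
    refine hNk.trans ?_
    have := mul_le_mul_of_nonneg_left hκm hk0
    linarith
  have hkm : 0 ≤ k * m := by positivity
  have hκ11 : 0 ≤ 1 - 11 * κ := by linarith
  have h4 : (1 - 11 * κ) * (1 + κ) ≤ (1 - 9 * κ) * (1 - κ) := by
    nlinarith [mul_pos hκ0 hκ0]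
  have h5 : (1 - 11 * κ) * N ≤ (1 - 9 * κ) * k * ((1 - κ) * m) := by
    calc (1 - 11 * κ) * N ≤ (1 - 11 * κ) * (k * m * (1 + κ)) := by gcongr
      _ = (1 - 11 * κ) * (1 + κ) * (k * m) := by ring
      _ ≤ (1 - 9 * κ) * (1 - κ) * (k * m) := by gcongr
      _ = _ := by ring
  have h6 : (1 - 11 * κ) * ((4 + δ) * n₁) ≤ (1 - 11 * κ) * N := by gcongr
  have h7 : 4 + δ / 2 ≤ (1 - 11 * κ) * (4 + δ) := by
    have : δ * δ ≤ δ := mul_le_of_le_one_left hδ.le hδ1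
    rw [hκ]
    linarith
  have h8 : (4 + δ / 2) * n₁ ≤ (1 - 11 * κ) * ((4 + δ) * n₁) := by
    rw [← mul_assoc]
    gcongr
  linarith

lemma exists_cluster_parameters {d κ δ : ℝ} (hd : 0 < d) (hd1 : d ≤ 1) (hδ : 0 < δ) (hδ1 : δ ≤ 1)
    (hκ : κ = δ / 1000) {L k m n n₁ N : ℕ} (hn : (1 - 9 * κ) * k ≤ n)
    (hm1 : 2 * (L + 6 + 2 / d) ≤ κ * m) (hm2 : 1 ≤ d * (d * (κ * κ)) * m) (hn₁ : 4 ≤ δ * n₁)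
    (hN : (4 + δ) * n₁ ≤ N) (hNk : (N : ℝ) ≤ k * (m + 1)) :
    ∃ s t a : ℕ, 0 < t ∧ 1 ≤ d * t ∧ t ≤ d * s ∧ t ≤ s ∧ d * (κ * κ) * (m + 1) ≤ t ∧
      a + L + 2 * s + 2 ≤ m ∧ 2 * (2 * n₁ + 1) ≤ n * a := by
  have hκ0 : 0 < κ := by rw [hκ]; positivity
  have hκ1 : κ ≤ 1 / 1000 := by rw [hκ]; linarith
  have hε : 0 < d * (κ * κ) := by positivity
  have hm0 : (0 : ℝ) ≤ m := by positivity
  obtain ⟨t, ht⟩ : ∃ t : ℕ, t = ⌈d * (κ * κ) * (m + 1)⌉₊ := ⟨_, rfl⟩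
  obtain ⟨s, hs⟩ : ∃ s : ℕ, s = ⌈t / d⌉₊ := ⟨_, rfl⟩
  have ht1 : d * (κ * κ) * (m + 1) ≤ t := by rw [ht]; exact Nat.le_ceil _
  have ht2 : t < d * (κ * κ) * (m + 1) + 1 := by rw [ht]; exact Nat.ceil_lt_add_one (by positivity)
  have hs1 : t / d ≤ s := by rw [hs]; exact Nat.le_ceil _
  have hs2 : s < t / d + 1 := by rw [hs]; exact Nat.ceil_lt_add_one (by positivity)
  have ht0 : (0 : ℝ) < t := lt_of_lt_of_le (by positivity) ht1
  have hts : (t : ℝ) ≤ d * s := by rw [div_le_iff₀ hd] at hs1; linarith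
  have hs3 : s ≤ κ * κ * (m + 1) + 1 / d + 1 := by
    have : (t : ℝ) / d ≤ κ * κ * (m + 1) + 1 / d := by
      rw [div_le_iff₀ hd, add_mul, one_div, inv_mul_cancel₀ hd.ne']
      nlinarith
    linarith
  have hcap : L + 2 * s + 2 ≤ κ * m := by
    have h1 : κ * κ * (m + 1) ≤ κ * m / 1000 + 1 := by nlinarith [mul_nonneg hκ0.le hm0]
    have h2 : 0 ≤ κ * m := by positivity
    have h3 : 2 / d = 2 * (1 / d) := by ring
    have h4 : 0 < 1 / d := by positivity
    have h5 : (0 : ℝ) ≤ L := by positivity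
    linarith
  have hle : L + 2 * s + 2 ≤ m := by
    have : ((L + 2 * s + 2 : ℕ) : ℝ) ≤ m := by push_cast; nlinarith
    exact_mod_cast this
  refine ⟨s, t, m - (L + 2 * s + 2), by exact_mod_cast ht0, ?_, hts, ?_, ht1, by omega, ?_⟩
  · nlinarith
  · have : (t : ℝ) ≤ s := by nlinarith [(Nat.cast_nonneg s : (0 : ℝ) ≤ s)]
    exact_mod_cast this
  · suffices h : ((2 * (2 * n₁ + 1) : ℕ) : ℝ) ≤ ((n * (m - (L + 2 * s + 2)) : ℕ) : ℝ) by
      exact_mod_cast h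
    push_cast [Nat.cast_sub hle]
    have h1 : (1 - κ) * m ≤ m - (L + 2 * s + 2) := by linarith
    have hk0 : (0 : ℝ) ≤ k := by positivity
    have h2 : (1 - 9 * κ) * k * ((1 - κ) * m) ≤ n * (m - (L + 2 * s + 2)) := by
      have : 0 ≤ (1 - κ) * m := mul_nonneg (by linarith) hm0
      have : 0 ≤ (1 - 9 * κ) * k := mul_nonneg (by linarith) hk0
      gcongr
    have hκm : 1 ≤ κ * m := by
      have h5 : (0 : ℝ) ≤ L := by positivity
      have : 0 < 2 / d := by positivity
      linarith
    have h3 := four_mul_add_two_le_of_clusters hδ hδ1 hκ hk0 hm0 (Nat.cast_nonneg n₁) hκm hn₁ hN hNk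
    linarith

lemma exists_arrowsCycles_of_uniformlyDense {d δ : ℝ} (hd : 0 < d) (hd1 : d ≤ 1) (hδ : 0 < δ)
    (hδ1 : δ ≤ 1) : ∃ η : ℝ, 0 < η ∧ ∃ n₀ : ℕ, ∀ n₁ n₂ N : ℕ, n₂ ≤ n₁ → n₀ < n₂ →
      (4 + δ) * n₁ ≤ N → ∀ F : SimpleGraph (Fin N), UniformlyDense F (4 * d) (η * N) →
        ArrowsCycles F ![2 * n₁ + 1, 2 * n₂ + 1] := by
  obtain ⟨κ, hκ⟩ : ∃ κ : ℝ, κ = δ / 1000 := ⟨_, rfl⟩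
  have hκ0 : 0 < κ := by rw [hκ]; positivity
  have hκ1 : κ ≤ 1 / 1000 := by rw [hκ]; linarith
  obtain ⟨ε, hεdef⟩ : ∃ ε : ℝ, ε = d * (κ * κ) := ⟨_, rfl⟩
  have hε0 : 0 < ε := by rw [hεdef]; positivity
  have hεκ : ε ≤ κ * κ := by
    rw [hεdef]
    exact mul_le_of_le_one_left (by positivity) hd1
  have hεd : ε ≤ d := by
    have : κ * κ ≤ 1 := by nlinarith
    rw [hεdef]
    exact mul_le_of_le_one_right hd.le this
  obtain ⟨l, hl⟩ := exists_nat_ge (1 / κ)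
  obtain ⟨K, hK⟩ : ∃ K : ℕ, K = SzemerediRegularity.bound ε l := ⟨_, rfl⟩
  have hK0 : 0 < K := hK ▸ SzemerediRegularity.bound_pos ε l
  obtain ⟨L, hL⟩ := exists_tour_bound K
  obtain ⟨m₁, hm₁⟩ := exists_nat_ge (2 * (L + 6 + 2 / d) / κ)
  obtain ⟨m₂, hm₂⟩ := exists_nat_ge (1 / (d * (d * (κ * κ))))
  obtain ⟨m₃, hm₃⟩ := exists_nat_ge (4 / δ)
  refine ⟨ε / K, by positivity, l + K * (m₁ + m₂ + 1) + m₃ + L + 3, ?_⟩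
  intro n₁ n₂ N hn hn₀ hN F hF c
  have hKl : l + m₁ + m₂ ≤ l + K * (m₁ + m₂ + 1) := by nlinarith
  have hNn : n₁ ≤ N := by
    have : (n₁ : ℝ) ≤ N := by nlinarith [(Nat.cast_nonneg n₁ : (0 : ℝ) ≤ n₁)]
    exact_mod_cast this
  set R := colorGraph F c 0
  set B := colorGraph F c 1
  have hFRB : F ≤ R ⊔ B := by
    intro u v huv
    have h2 : ∀ x : Fin 2, x = 0 ∨ x = 1 := by decide
    rcases h2 (c ⟨s(u, v), huv⟩) with h | h
    · exact Or.inl ⟨huv, h⟩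
    · exact Or.inr ⟨huv, h⟩
  obtain ⟨P, hPe, hPl, hPK, hPu⟩ := szemeredi_regularity R hε0 (l := l) (by
    rw [Fintype.card_fin]; omega)
  obtain ⟨k, hk⟩ : ∃ k : ℕ, k = #P.parts := ⟨_, rfl⟩
  rw [← hk] at hPl hPK
  rw [← hK] at hPK
  have hκk : 1 ≤ κ * k := by
    have h1 : (l : ℝ) ≤ k := by exact_mod_cast hPl
    have h2 := hl.trans h1
    rw [div_le_iff₀ hκ0] at h2
    linarith
  have hk0 : 0 < k := by
    rcases Nat.eq_zero_or_pos k with rfl | h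
    · norm_num at hκk
    · exact h
  have e : Fin k ≃ P.parts := (finCongr hk).trans P.parts.equivFin.symm
  set W : Fin k → Finset (Fin N) := fun i ↦ e i with hW
  obtain ⟨m, hm⟩ : ∃ m : ℕ, m = N / k := ⟨_, rfl⟩
  have hWm : ∀ i, m ≤ #(W i) := by
    intro i
    have := hPe.average_le_card_part (e i).2
    rwa [card_univ, Fintype.card_fin, ← hk, ← hm] at this
  have hWm' : ∀ i, #(W i) ≤ m + 1 := by
    intro i
    have := hPe.card_part_le_average_add_one (e i).2
    rwa [card_univ, Fintype.card_fin, ← hk, ← hm] at this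
  have hdisj : ∀ i j, i ≠ j → Disjoint (W i) (W j) := by
    intro i j hij
    exact P.disjoint (e i).2 (e j).2 fun h ↦ hij (e.injective (Subtype.ext h))
  have hNk : N ≤ k * (m + 1) := by
    rw [hm]; exact (Nat.lt_mul_div_succ N hk0).le
  have hm12 : m₁ + m₂ ≤ m := by
    rw [hm, Nat.le_div_iff_mul_le hk0]
    nlinarith
  obtain ⟨U, hUcard, hU⟩ := exists_nearly_regular_subset hκ0 hεκ hPu hk hk0 e
  obtain ⟨D, hD⟩ : ∃ D : ℕ, D = ⌊2 * κ * k⌋₊ := ⟨_, rfl⟩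
  have hk0' : (0 : ℝ) < k := by exact_mod_cast hk0
  have hD' : D ≤ 2 * κ * k := by rw [hD]; exact Nat.floor_le (by positivity)
  have hUD : 8 * D < #U := by
    have : ((8 * D : ℕ) : ℝ) < #U := by push_cast; nlinarith
    exact_mod_cast this
  have hn9 : (1 - 9 * κ) * k ≤ ((#U - 4 * D : ℕ) : ℝ) := by
    rw [Nat.cast_sub (by omega)]
    push_cast
    linarith
  have hm' : (m₁ : ℝ) + m₂ ≤ m := by exact_mod_cast hm12
  have hm₁0 : (0 : ℝ) ≤ m₁ := by positivity
  have hm₂0 : (0 : ℝ) ≤ m₂ := by positivity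
  obtain ⟨s, t, a, ht, hdt, hds, hts, htm, ha, hla⟩ := exists_cluster_parameters hd hd1 hδ hδ1 hκ
    hn9 (L := L) (m := m) (n₁ := n₁) (N := N)
    (by
      have h1 : 2 * (L + 6 + 2 / d) / κ ≤ m := by linarith
      rw [div_le_iff₀ hκ0] at h1
      linarith)
    (by
      have h1 : 1 / (d * (d * (κ * κ))) ≤ m := by linarith
      rw [div_le_iff₀ (by positivity)] at h1
      linarith)
    (by
      have h1 : (m₃ : ℝ) ≤ n₁ := by exact_mod_cast (by omega : m₃ ≤ n₁)
      have h2 := hm₃.trans h1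
      rw [div_le_iff₀ hδ] at h2
      linarith)
    hN (by exact_mod_cast hNk)
  rw [← hεdef] at htm
  have hWt : ∀ i, #(W i) * ε ≤ t := by
    intro i
    have : (#(W i) : ℝ) ≤ m + 1 := by exact_mod_cast hWm' i
    nlinarith
  have hηt : ε / K * N ≤ t := by
    have h1 : (N : ℝ) ≤ K * (m + 1) := by
      exact_mod_cast hNk.trans (Nat.mul_le_mul_right _ hPK)
    have hK0' : (0 : ℝ) < K := by exact_mod_cast hK0
    calc ε / K * N ≤ ε / K * (K * (m + 1)) := by gcongr
      _ = ε * (m + 1) := by field_simp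
      _ ≤ t := htm
  have hcolor : ∀ H, HasOddConnectedMatching (clusterGraph H d t W) (#U - 4 * D) →
      ∀ n, L + 3 ≤ n → n ≤ n₁ → ∃ (x : _) (c : H.Walk x x), c.IsCycle ∧ c.length = 2 * n + 1 := by
    intro H hH n hn1 hn2
    exact exists_isCycle_of_hasOddConnectedMatching ht hdt hds hts hdisj hWm
      (fun r h ↦ hL k hPK _ r h) hH ha ⟨n, rfl⟩ (by omega) (by omega) (by omega)
  have hfew : ∀ u ∈ U, #{x ∈ U | ¬ (clusterGraph R d t W).Adj u x ∧
      ¬ (clusterGraph B d t W).Adj u x} ≤ D := by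
    intro u hu
    have hsub : {x ∈ U | ¬ (clusterGraph R d t W).Adj u x ∧ ¬ (clusterGraph B d t W).Adj u x} ⊆
        insert u (univ.filter fun j ↦
          u ≠ j ∧ ¬ R.IsUniform ε (e u : Finset (Fin N)) (e j)) := by
      intro x hx
      rw [mem_filter] at hx
      rw [mem_insert, mem_filter]
      by_cases hux : x = u
      · exact Or.inl hux
      · refine Or.inr ⟨mem_univ _, Ne.symm hux, fun hunif ↦ ?_⟩
        rcases lowerDense_or_of_isUniform hFRB hεd hF (hdisj u x (Ne.symm hux)) hunif ht
          (hWt u) (hWt x) hηt with h | h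
        · exact hx.2.1 ⟨Ne.symm hux, h⟩
        · exact hx.2.2 ⟨Ne.symm hux, h⟩
    have hcard := (card_le_card hsub).trans (card_insert_le _ _)
    have hUu := hU u hu
    rw [hD]
    refine Nat.le_floor ?_
    calc _ ≤ ((#{j | u ≠ j ∧ ¬ R.IsUniform ε (e u : Finset (Fin N)) (e j)} + 1 : ℕ) : ℝ) := by
          exact_mod_cast hcard
      _ ≤ _ := by push_cast; linarith
  rcases hasOddConnectedMatching_or hfew hUD with h | h
  · obtain ⟨x, w, hw, hlen⟩ := hcolor R h n₁ (by omega) le_rfl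
    exact ⟨0, by simpa [hlen] using hasMonoCycle_of_isCycle hw⟩
  · obtain ⟨x, w, hw, hlen⟩ := hcolor B h n₂ (by omega) hn
    exact ⟨1, by simpa [hlen] using hasMonoCycle_of_isCycle hw⟩

end

theorem stmt1 (p : ℝ) (hp0 : 0 < p) (hp1 : p ≤ 1) :
    ∃ δ₀ : ℝ, 0 < δ₀ ∧ ∀ δ : ℝ, 0 < δ → δ < δ₀ → ∀ ε : ℝ, 0 < ε →
      ∃ n₀ : ℕ, ∀ n₁ n₂ : ℕ, n₂ ≤ n₁ → n₀ < n₂ →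
        1 - ε ≤ graphProbability (⌈(4 + δ) * (n₁ : ℝ)⌉₊) p
          {G | ArrowsCycles G ![2 * n₁ + 1, 2 * n₂ + 1]} := by
  refine ⟨1, one_pos, fun δ hδ hδ1 ε hε ↦ ?_⟩
  obtain ⟨η, hη, n₀, hn₀⟩ := exists_arrowsCycles_of_uniformlyDense (d := p / 16) (by positivity)
    (by linarith) hδ hδ1.le
  obtain ⟨N₀, hN₀⟩ := exists_le_graphProbability hp0 hp1 hη hε
  refine ⟨n₀ + N₀, fun n₁ n₂ hn hlt ↦ ?_⟩
  have hceil : (4 + δ) * (n₁ : ℝ) ≤ (⌈(4 + δ) * (n₁ : ℝ)⌉₊ : ℕ) := Nat.le_ceil _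
  refine hN₀ _ ?_ _ fun G hG ↦ hn₀ n₁ n₂ _ hn (by omega) hceil G ?_
  · have h1 : (n₁ : ℝ) ≤ (⌈(4 + δ) * (n₁ : ℝ)⌉₊ : ℕ) := by
      nlinarith [(Nat.cast_nonneg n₁ : (0 : ℝ) ≤ n₁)]
    have h2 : n₁ ≤ ⌈(4 + δ) * (n₁ : ℝ)⌉₊ := by exact_mod_cast h1
    omega
  · have : 4 * (p / 16) = p / 4 := by ring
    rwa [this]
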